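/- arXiv:1910.02278 — 2 statements merged into one kernel-verified Lean document; each statement's English description precedes it below -/
import Mathlib

section
/- Let q be an odd prime power, F a finite field with q^6 elements, and h ∈ F with h^(q^3+1) = −1 and h^(q^2) ≠ h (i.e., h ∉ F_(q^2)). Then 𝓛_h is not PΓL-equivalent to L^4_δ for any δ ∈ F with δ^2 + δ = 1. -/
/-- The linear set `L_f` in `ℙ(F × F)` of a map `f : F → F`: the set of projective
points (F-spans) `[(x, f x)]` for `x ∈ F`, `x ≠ 0`. -/
def linearSet {F : Type} [Field F] (f : F → F) : Set (Projectivization F (F × F)) :=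
  {P | ∃ (x : F) (hx : x ≠ 0),
    P = Projectivization.mk F (x, f x) (fun h0 => hx (congrArg Prod.fst h0))}

/-- Two subsets of `ℙ(F × F)` are PΓL-equivalent if there exist a field automorphism
`ρ` of `F` and a bijective `ρ`-semilinear map `g : F × F → F × F` whose induced map on
`ℙ(F × F)` maps `L` onto `L'`. (A bijective additive `ρ`-semilinear map sends nonzero
vectors to nonzero vectors, so the induced map on projective points is total; requiring
the membership equivalence for all nonzero `v` says exactly that the induced bijection
maps `L` onto `L'`.) -/
def IsPGammaLEquiv {F : Type} [Field F] (L L' : Set (Projectivization F (F × F))) : Prop :=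
  ∃ (ρ : F ≃+* F) (g : (F × F) ≃ (F × F)),
    (∀ u v : F × F, g (u + v) = g u + g v) ∧
    (∀ (c : F) (v : F × F), g (c • v) = ρ c • g v) ∧
    (∀ (v : F × F) (hv : v ≠ 0) (hgv : g v ≠ 0),
      (Projectivization.mk F v hv ∈ L ↔ Projectivization.mk F (g v) hgv ∈ L'))

/-- The `q`-polynomial `f_h(x) = h^(q−1)·x^q − h^(q^2−1)·x^(q^2) + x^(q^4) + x^(q^5)`. -/
def fpol (q : ℕ) {F : Type} [Field F] (h : F) : F → F :=
  fun x => h ^ (q - 1) * x ^ q - h ^ (q ^ 2 - 1) * x ^ (q ^ 2) + x ^ (q ^ 4) + x ^ (q ^ 5)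


/-- character sums -/
theorem charsum {F : Type} [Field F] [Fintype F] [DecidableEq F] (n m : ℕ) :
    ∑ x : Fˣ, ((x : F) ^ n / (x : F) ^ m) =
      if n ≡ m [MOD Fintype.card F - 1] then -1 else 0 := by
  have hN : 0 < Fintype.card F - 1 := by
    have := Fintype.one_lt_card (α := F); omega
  set N := Fintype.card F - 1 with hNdef
  have h1 : ∀ x : Fˣ, ((x : F) ^ n / (x : F) ^ m) = (x : F) ^ (n + (N - 1) * m) := by
    intro x
    have hx : (x : F) ≠ 0 := x.ne_zero
    have hc : (x : F) ^ N = 1 := FiniteField.pow_card_sub_one_eq_one _ hx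
    rw [div_eq_iff (pow_ne_zero _ hx), ← pow_add]
    have : n + (N - 1) * m + m = n + N * m := by
      obtain ⟨k, hk⟩ : ∃ k, N = k + 1 := ⟨N - 1, by omega⟩
      rw [hk]; simp; ring
    rw [this, pow_add, pow_mul, hc, one_pow, mul_one]
  simp_rw [h1]
  rw [FiniteField.sum_pow_units]
  congr 1
  rw [← hNdef]
  apply propext
  have e : N ∣ n + (N - 1) * m ↔ (n + (N-1) * m) ≡ 0 [MOD N] := (Nat.modEq_zero_iff_dvd).symm
  rw [e]
  have hz : m + (N - 1) * m ≡ 0 [MOD N] := by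
    rw [Nat.modEq_zero_iff_dvd]
    refine ⟨m, ?_⟩
    obtain ⟨k, hk⟩ : ∃ k, N = k + 1 := ⟨N - 1, by omega⟩
    rw [hk]; simp; ring
  constructor
  · intro h
    exact Nat.ModEq.add_right_cancel' _ (h.trans hz.symm)
  · intro h
    exact (h.add_right _).trans hz

theorem modEq_eq {N a b : ℕ} (h : a ≡ b [MOD N]) (h1 : a < b + N) (h2 : b < a + N) : a = b := by
  rcases le_total a b with hab | hab
  · have := (Nat.modEq_iff_dvd' hab).1 h
    have := Nat.eq_zero_of_dvd_of_lt this (by omega)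
    omega
  · have := (Nat.modEq_iff_dvd' hab).1 h.symm
    have := Nat.eq_zero_of_dvd_of_lt this (by omega)
    omega

theorem qpow_mod (q a : ℕ) : q ^ a % q = if a = 0 then 1 % q else 0 := by
  split_ifs with h
  · simp [h]
  · exact Nat.mod_eq_zero_of_dvd (dvd_pow_self q h)

theorem two_pows (q : ℕ) (hq : 3 ≤ q) (a b k : ℕ) (hk : 0 < k) 
    (h : q ^ a + q ^ b = 1 + q ^ k) : (a = 0 ∧ b = k) ∨ (a = k ∧ b = 0) := by
  have hm : (q ^ a + q ^ b) % q = (1 + q ^ k) % q := by rw [h]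
  have inj : ∀ i j, q ^ i = q ^ j → i = j := fun i j hij => Nat.pow_right_injective (by omega) hij
  rw [Nat.add_mod, qpow_mod, qpow_mod, Nat.add_mod 1, qpow_mod] at hm
  have e1 : 1 % q = 1 := Nat.mod_eq_of_lt (by omega)
  have e2 : 2 % q = 2 := Nat.mod_eq_of_lt (by omega)
  by_cases ha : a = 0 <;> by_cases hb : b = 0 <;> simp [ha, hb, e1, e2, hk.ne'] at hm h ⊢
  · exact inj _ _ h
  · exact inj _ _ (by omega)

theorem three_pows (q : ℕ) (hq : 3 ≤ q) (a b c : ℕ) 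
    (h : q ^ a + q ^ b + q ^ c = 1 + q + q ^ 2) :
    (a = 0 ∧ b = 1 ∧ c = 2) ∨ (a = 0 ∧ b = 2 ∧ c = 1) ∨ (a = 1 ∧ b = 0 ∧ c = 2) ∨
    (a = 1 ∧ b = 2 ∧ c = 0) ∨ (a = 2 ∧ b = 0 ∧ c = 1) ∨ (a = 2 ∧ b = 1 ∧ c = 0) := by
  have key : ∀ a b : ℕ, a ≠ 0 → b ≠ 0 → q ^ a + q ^ b = q + q ^ 2 → (a = 1 ∧ b = 2) ∨ (a = 2 ∧ b = 1) := by
    intro a b ha hb h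
    obtain ⟨a, rfl⟩ := Nat.exists_eq_succ_of_ne_zero ha
    obtain ⟨b, rfl⟩ := Nat.exists_eq_succ_of_ne_zero hb
    have := two_pows q hq a b 1 one_pos (by
      have : q * (q ^ a + q ^ b) = q * (1 + q ^ 1) := by
        simp only [pow_succ] at h ⊢; nlinarith
      exact Nat.eq_of_mul_eq_mul_left (by omega) this)
    omega
  have hm : (q ^ a + q ^ b + q ^ c) % q = 1 := by
    rw [h, Nat.add_mod, qpow_mod]; simp; exact Nat.mod_eq_of_lt (by omega)
  rw [Nat.add_mod, Nat.add_mod (q ^ a), qpow_mod, qpow_mod, qpow_mod] at hm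
  have e1 : 1 % q = 1 := Nat.mod_eq_of_lt (by omega)
  have e2 : 2 % q = 2 := Nat.mod_eq_of_lt (by omega)
  by_cases ha : a = 0 <;> by_cases hb : b = 0 <;> by_cases hc : c = 0 <;> 
    simp [ha, hb, hc, e1, e2] at hm h ⊢
  · rcases (show q = 3 ∨ 3 < q by omega) with h3 | h3
    · subst h3; simp at hm
    · rw [Nat.mod_eq_of_lt h3] at hm; omega
  · have := key b c hb hc (by omega); omega
  · have := key a c ha hc (by omega); omega
  · have := key a b ha hb (by omega); omega

section
variable {F : Type} [Field F] [Fintype F] [DecidableEq F] {q : ℕ}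

theorem cs1 (hq : 3 ≤ q) (hF : Fintype.card F = q ^ 6) (i k : Fin 6) :
    ∑ x : Fˣ, ((x : F) ^ q ^ (i : ℕ) / (x : F) ^ q ^ (k : ℕ)) = if i = k then -1 else 0 := by
  rw [charsum, hF]
  congr 1
  apply propext
  have B : ∀ i : Fin 6, 1 ≤ q ^ (i : ℕ) ∧ q ^ (i : ℕ) ≤ q ^ 5 := fun i =>
    ⟨Nat.one_le_pow _ _ (by omega), Nat.pow_le_pow_right (by omega) (by omega)⟩
  have h5 : 3 * q ^ 5 ≤ q ^ 6 := by rw [pow_succ q 5]; nlinarith [(B 5).1]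
  constructor
  · intro h
    have := modEq_eq h (by have := B i; have := B k; omega) (by have := B i; have := B k; omega)
    exact Fin.ext (Nat.pow_right_injective (by omega) this)
  · rintro rfl; rfl

theorem cs2 (hq : 3 ≤ q) (hF : Fintype.card F = q ^ 6) (k : Fin 6) (hk : k ≠ 0) (i j : Fin 6) :
    ∑ x : Fˣ, ((x : F) ^ (q ^ (i : ℕ) + q ^ (j : ℕ)) / (x : F) ^ (1 + q ^ (k : ℕ))) =
      if (i = 0 ∧ j = k) ∨ (i = k ∧ j = 0) then -1 else 0 := by
  rw [charsum, hF]
  congr 1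
  apply propext
  have B : ∀ i : Fin 6, 1 ≤ q ^ (i : ℕ) ∧ q ^ (i : ℕ) ≤ q ^ 5 := fun i =>
    ⟨Nat.one_le_pow _ _ (by omega), Nat.pow_le_pow_right (by omega) (by omega)⟩
  have h5 : 3 * q ^ 5 ≤ q ^ 6 := by rw [pow_succ q 5]; nlinarith [(B 5).1]
  have h55 : 3 ≤ q ^ 5 := le_trans hq (Nat.le_self_pow (by norm_num) _)
  constructor
  · intro h
    have := modEq_eq h (by have := B i; have := B j; have := B k; omega)
      (by have := B i; have := B j; have := B k; omega)
    have := two_pows q hq i j k (by omega) this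
    simp only [Fin.ext_iff]; simpa using this
  · rintro (⟨rfl, rfl⟩ | ⟨rfl, rfl⟩) <;> simp
    · rfl
    · rw [add_comm]

theorem cs3 (hq : 3 ≤ q) (hF : Fintype.card F = q ^ 6) (i j l : Fin 6) :
    ∑ x : Fˣ, ((x : F) ^ (q ^ (i : ℕ) + q ^ (j : ℕ) + q ^ (l : ℕ)) / (x : F) ^ (1 + q + q ^ 2)) =
      if (i = 0 ∧ j = 1 ∧ l = 2) ∨ (i = 0 ∧ j = 2 ∧ l = 1) ∨ (i = 1 ∧ j = 0 ∧ l = 2) ∨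
    (i = 1 ∧ j = 2 ∧ l = 0) ∨ (i = 2 ∧ j = 0 ∧ l = 1) ∨ (i = 2 ∧ j = 1 ∧ l = 0) then -1 else 0 := by
  rw [charsum, hF]
  congr 1
  apply propext
  have B : ∀ i : Fin 6, 1 ≤ q ^ (i : ℕ) ∧ q ^ (i : ℕ) ≤ q ^ 5 := fun i =>
    ⟨Nat.one_le_pow _ _ (by omega), Nat.pow_le_pow_right (by omega) (by omega)⟩
  have h5 : 3 * q ^ 5 ≤ q ^ 6 := by rw [pow_succ q 5]; nlinarith [(B 5).1]
  have h52 : 27 * q ^ 2 ≤ q ^ 5 := by 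
    have : 3 ^ 3 ≤ q ^ 3 := Nat.pow_le_pow_left hq 3
    calc 27 * q ^ 2 ≤ q ^ 3 * q ^ 2 := Nat.mul_le_mul_right _ this
      _ = q ^ 5 := by ring
  have h21 : q ≤ q ^ 2 := Nat.le_self_pow (by norm_num) _
  constructor
  · intro h
    have := modEq_eq h (by have := B i; have := B j; have := B l; omega)
      (by have := B i; have := B j; have := B l; omega)
    have := three_pows q hq i j l this
    simp only [Fin.ext_iff]; simpa using this
  · rintro (⟨rfl, rfl, rfl⟩ | ⟨rfl, rfl, rfl⟩ | ⟨rfl, rfl, rfl⟩ | ⟨rfl, rfl, rfl⟩ | ⟨rfl, rfl, rfl⟩ | ⟨rfl, rfl, rfl⟩) <;> simp <;> 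
     (refine (congrArg (· % (q ^ 6 - 1)) ?_); ring)

/-- evaluation of a q-polynomial -/
def ev {F : Type} [Field F] (q : ℕ) (c : Fin 6 → F) (x : F) : F := ∑ i : Fin 6, c i * x ^ q ^ (i : ℕ)

theorem T1 (hq : 3 ≤ q) (hF : Fintype.card F = q ^ 6) (c : Fin 6 → F) (k : Fin 6) :
    ∑ x : Fˣ, (ev q c x / (x : F) ^ q ^ (k : ℕ)) = - c k := by
  simp only [ev, Finset.sum_div, mul_div_assoc]
  rw [Finset.sum_comm]
  simp only [← Finset.mul_sum, cs1 hq hF]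
  simp

theorem T2 (hq : 3 ≤ q) (hF : Fintype.card F = q ^ 6) (c d : Fin 6 → F) (k : Fin 6) (hk : k ≠ 0) :
    ∑ x : Fˣ, (ev q c x * ev q d x / (x : F) ^ (1 + q ^ (k : ℕ))) = - (c 0 * d k + c k * d 0) := by
  have : ∀ x : Fˣ, (ev q c x * ev q d x / (x : F) ^ (1 + q ^ (k : ℕ))) = 
     ∑ i : Fin 6, ∑ j : Fin 6, c i * d j * ((x : F) ^ (q ^ (i : ℕ) + q ^ (j : ℕ)) / (x : F) ^ (1 + q ^ (k : ℕ))) := by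
    intro x
    rw [ev, ev, Finset.sum_mul_sum, Finset.sum_div]
    refine Finset.sum_congr rfl fun i _ => ?_
    rw [Finset.sum_div]
    refine Finset.sum_congr rfl fun j _ => ?_
    rw [pow_add]; ring
  simp only [this]
  rw [Finset.sum_comm]
  simp_rw [Finset.sum_comm (s := (Finset.univ : Finset Fˣ)), ← Finset.mul_sum, cs2 hq hF k hk]
  fin_cases k
  · simp at hk
  all_goals simp [Fin.sum_univ_six]
  all_goals ring

theorem T3 (hq : 3 ≤ q) (hF : Fintype.card F = q ^ 6) (c d e : Fin 6 → F) :
    ∑ x : Fˣ, (ev q c x * ev q d x * ev q e x / (x : F) ^ (1 + q + q ^ 2)) = 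
    - (c 0 * d 1 * e 2 + c 0 * d 2 * e 1 + c 1 * d 0 * e 2 + c 1 * d 2 * e 0 + 
       c 2 * d 0 * e 1 + c 2 * d 1 * e 0) := by
  have : ∀ x : Fˣ, (ev q c x * ev q d x * ev q e x / (x : F) ^ (1 + q + q ^ 2)) = 
     ∑ i : Fin 6, ∑ j : Fin 6, ∑ l : Fin 6, c i * d j * e l * 
     ((x : F) ^ (q ^ (i : ℕ) + q ^ (j : ℕ) + q ^ (l : ℕ)) / (x : F) ^ (1 + q + q ^ 2)) := by
    intro x
    rw [ev, ev, ev, Finset.sum_mul_sum, Finset.sum_mul, Finset.sum_div]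
    refine Finset.sum_congr rfl fun i _ => ?_
    rw [Finset.sum_mul_sum, Finset.sum_div]
    refine Finset.sum_congr rfl fun j _ => ?_
    rw [Finset.sum_div]
    refine Finset.sum_congr rfl fun l _ => ?_
    rw [pow_add, pow_add]; ring
  simp only [this]
  rw [Finset.sum_comm]
  simp_rw [Finset.sum_comm (s := (Finset.univ : Finset Fˣ)), ← Finset.mul_sum, cs3 hq hF]
  simp [Fin.sum_univ_six]
  ring

theorem powsum_eq (p : ℕ) [Fact p.Prime] [CharP F p] (f : F →+ F) (d : ℕ) :
    ∑ x : Fˣ, (f x / x) ^ d = - ∑ m ∈ Finset.univ.image (fun x : Fˣ => f x / (x : F)), m ^ d := by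
  rw [← Finset.sum_fiberwise_of_maps_to (s := Finset.univ)
    (t := Finset.univ.image (fun x : Fˣ => f x / (x : F))) (g := fun x : Fˣ => f x / (x : F))
    (fun x _ => Finset.mem_image_of_mem _ (Finset.mem_univ _)), ← Finset.sum_neg_distrib]
  refine Finset.sum_congr rfl fun m hm => ?_
  rw [Finset.sum_congr rfl (g := fun _ => m ^ d) (by
    intro x hx; rw [(Finset.mem_filter.1 hx).2])]
  rw [Finset.sum_const, nsmul_eq_mul]
  suffices h : ((Finset.univ.filter (fun x : Fˣ => f x / (x : F) = m)).card : F) = -1 by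
    rw [h]; ring
  obtain ⟨x0, -, hx0⟩ := Finset.mem_image.1 hm
  let K : AddSubgroup F := (f - AddMonoidHom.mulLeft m).ker
  have hK : ∀ x, x ∈ K ↔ f x = m * x := by
    intro x; simp [K, AddMonoidHom.mem_ker, sub_eq_zero]
  have hcard : (Finset.univ.filter (fun x : Fˣ => f x / (x : F) = m)).card + 1 = Nat.card K := by
    have e1 : Nat.card K = (Finset.univ.filter (fun x : F => f x = m * x)).card := by
      rw [← Fintype.card_subtype, ← Nat.card_eq_fintype_card]
      exact Nat.card_congr (Equiv.subtypeEquivRight (fun x => hK x))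
    rw [e1]
    have e2 : (Finset.univ.filter (fun x : F => f x = m * x)) = 
       insert 0 ((Finset.univ.filter (fun x : Fˣ => f x / (x : F) = m)).map ⟨Units.val, Units.val_injective⟩) := by
      ext x
      simp only [Finset.mem_filter, Finset.mem_univ, true_and, Finset.mem_insert, Finset.mem_map,
        Function.Embedding.coeFn_mk]
      constructor
      · intro h
        by_cases hx : x = 0
        · exact Or.inl hx
        · right
          exact ⟨Units.mk0 x hx, by simp [h, hx], rfl⟩
      · rintro (rfl | ⟨y, hy, rfl⟩)
        · simp
        · rwa [div_eq_iff y.ne_zero] at hy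
    rw [e2, Finset.card_insert_of_notMem (by simp), Finset.card_map]
  have hdvd : p ∣ Nat.card K := by
    have hx0K : (x0 : F) ∈ K := by rw [hK, ← hx0]; field_simp [x0.ne_zero]
    have h1 : addOrderOf (⟨x0, hx0K⟩ : K) ∣ Nat.card K := addOrderOf_dvd_natCard _
    have h2 : addOrderOf (⟨x0, hx0K⟩ : K) = p := by
      apply addOrderOf_eq_prime
      · apply Subtype.ext; simp
      · intro h; exact x0.ne_zero (congrArg Subtype.val h)
    rwa [h2] at h1
  have : ((Nat.card K : ℕ) : F) = 0 := (CharP.cast_eq_zero_iff F p _).2 hdvd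
  rw [← hcard] at this
  push_cast at this
  exact eq_neg_of_add_eq_zero_left this
end

section
variable {F : Type} [Field F] [Fintype F] [DecidableEq F] {q : ℕ}

/-- Frobenius twist of coefficients -/
def shiftc {F : Type} [Field F] (σ : F →+* F) (c : Fin 6 → F) : Fin 6 → F :=
  ![σ (c 5), σ (c 0), σ (c 1), σ (c 2), σ (c 3), σ (c 4)]

theorem ev_eq {F : Type} [Field F] (q : ℕ) (σ : F →+* F) (hσ : ∀ x, σ x = x ^ q) (c : Fin 6 → F) (x : F) :
    ev q c x = c 0 * x + c 1 * σ x + c 2 * σ (σ x) + c 3 * σ (σ (σ x)) + c 4 * σ (σ (σ (σ x)))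
      + c 5 * σ (σ (σ (σ (σ x)))) := by
  simp only [ev, Fin.sum_univ_six, hσ, ← pow_mul]
  simp
  ring_nf

theorem ev_shift {F : Type} [Field F] (q : ℕ) (σ : F →+* F) (hσ : ∀ x, σ x = x ^ q)
    (h6 : ∀ x, σ (σ (σ (σ (σ (σ x))))) = x) (c : Fin 6 → F) (x : F) :
    ev q (shiftc σ c) x = σ (ev q c x) := by
  rw [ev_eq q σ hσ, ev_eq q σ hσ]
  simp [shiftc, h6]
  ring

/-- q-polynomial maps -/
def IsQ {F : Type} [Field F] (q : ℕ) (f : F → F) : Prop := ∃ c : Fin 6 → F, ∀ x, f x = ev q c x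

theorem IsQ.comp {F : Type} [Field F] {q : ℕ} (σ : F →+* F) (hσ : ∀ x, σ x = x ^ q)
    (h6 : ∀ x, σ (σ (σ (σ (σ (σ x))))) = x) {f g : F → F} (hf : IsQ q f) (hg : IsQ q g) :
    IsQ q (f ∘ g) := by
  obtain ⟨c, hc⟩ := hf
  obtain ⟨d, hd⟩ := hg
  set s := shiftc σ
  refine ⟨fun i => c 0 * d i + c 1 * s d i + c 2 * s (s d) i + c 3 * s (s (s d)) i +
    c 4 * s (s (s (s d))) i + c 5 * s (s (s (s (s d)))) i, fun x => ?_⟩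
  rw [Function.comp, hc, hd, ev_eq q σ hσ c]
  simp only [← ev_shift q σ hσ h6]
  simp only [ev, Fin.sum_univ_six]
  ring

theorem IsQ.id {F : Type} [Field F] {q : ℕ} (σ : F →+* F) (hσ : ∀ x, σ x = x ^ q) : IsQ q (fun x : F => x) := by
  refine ⟨![1, 0, 0, 0, 0, 0], fun x => ?_⟩
  rw [ev_eq q σ hσ]; simp

theorem IsQ.iter {F : Type} [Field F] {q : ℕ} (σ : F →+* F) (hσ : ∀ x, σ x = x ^ q)
    (h6 : ∀ x, σ (σ (σ (σ (σ (σ x))))) = x) {f : F → F} (hf : IsQ q f) (n : ℕ) :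
    IsQ q (f^[n]) := by
  induction n with
  | zero => exact IsQ.id σ hσ
  | succ n ih => exact IsQ.comp σ hσ h6 ih hf

theorem exists_left_inv {F : Type} [Field F] [Fintype F] {q : ℕ} (σ : F →+* F) (hσ : ∀ x, σ x = x ^ q)
    (h6 : ∀ x, σ (σ (σ (σ (σ (σ x))))) = x) {A : F → F} (hA : IsQ q A) (hb : Function.Bijective A) :
    ∃ c : Fin 6 → F, ∀ x, ev q c (A x) = x := by
  let e : Equiv.Perm F := Equiv.ofBijective A hb
  have hfin : 0 < orderOf e := orderOf_pos e
  obtain ⟨n, hn⟩ : ∃ n, orderOf e = n + 1 := ⟨orderOf e - 1, by omega⟩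
  obtain ⟨c, hc⟩ := IsQ.iter σ hσ h6 hA n
  refine ⟨c, fun x => ?_⟩
  rw [← hc, ← Function.iterate_succ_apply]
  have h1 : (e ^ (n + 1)) x = x := by rw [← hn, pow_orderOf_eq_one]; rfl
  rw [← Equiv.Perm.iterate_eq_pow] at h1
  exact h1

theorem ev_unique (hq : 3 ≤ q) (hF : Fintype.card F = q ^ 6) (c : Fin 6 → F)
    (h : ∀ x, ev q c x = 0) : c = 0 := by
  funext k
  have := T1 hq hF c k
  simp only [h, zero_div, Finset.sum_const_zero] at this
  simpa using this.symm

theorem sigma_unique (hq : 3 ≤ q) (hF : Fintype.card F = q ^ 6) (σ : F →+* F) (hσ : ∀ x, σ x = x ^ q)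
    (a0 a1 a2 a3 a4 a5 : F) (h : ∀ x, a0 * x + a1 * σ x + a2 * σ (σ x) + a3 * σ (σ (σ x)) + a4 * σ (σ (σ (σ x)))
      + a5 * σ (σ (σ (σ (σ x)))) = 0) : a0 = 0 ∧ a1 = 0 ∧ a2 = 0 ∧ a3 = 0 ∧ a4 = 0 ∧ a5 = 0 := by
  have := ev_unique hq hF ![a0, a1, a2, a3, a4, a5] (fun x => by
    rw [ev_eq q σ hσ]; simpa using h x)
  exact ⟨congrFun this 0, congrFun this 1, congrFun this 2, congrFun this 3, congrFun this 4, congrFun this 5⟩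

/-- the additive map of a q-polynomial -/
def evHom {F : Type} [Field F] (q : ℕ) (σ : F →+* F) (hσ : ∀ x, σ x = x ^ q) (c : Fin 6 → F) : F →+ F where
  toFun := ev q c
  map_zero' := by rw [ev_eq q σ hσ]; simp
  map_add' x y := by simp only [ev_eq q σ hσ, map_add]; ring

theorem coeffs (hq : 3 ≤ q) (hF : Fintype.card F = q ^ 6) (p : ℕ) [Fact p.Prime] [CharP F p]
    (σ : F →+* F) (hσ : ∀ x, σ x = x ^ q)
    (h6 : ∀ x, σ (σ (σ (σ (σ (σ x))))) = x) (c : Fin 6 → F) (δ : F) (hδ : δ ≠ 0)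
    (him : Finset.univ.image (fun x : Fˣ => ev q c x / (x : F)) = 
      Finset.univ.image (fun x : Fˣ => ev q ![0, 1, 0, 1, 0, δ] x / (x : F))) :
    c 0 = 0 ∧ c 2 = 0 ∧ c 4 = 0 ∧ c 1 * σ (c 5) = σ δ ∧ c 3 * σ (σ (σ (c 3))) = 1 := by
  have S : ∀ d : ℕ, ∑ x : Fˣ, (ev q c x / (x : F)) ^ d = 
      ∑ x : Fˣ, (ev q ![0, 1, 0, 1, 0, δ] x / (x : F)) ^ d := by
    intro d
    have e1 := powsum_eq p (evHom q σ hσ c) d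
    have e2 := powsum_eq p (evHom q σ hσ ![0, 1, 0, 1, 0, δ]) d
    have h1 : ∀ c x, evHom q σ hσ c x = ev q c x := fun _ _ => rfl
    simp only [h1] at e1 e2
    rw [e1, e2, him]
  have s1 : ∀ (c : Fin 6 → F) (x : F), (ev q c x) ^ q = ev q (shiftc σ c) x := by
    intro c x; rw [ev_shift q σ hσ h6, hσ]
  have s2 : ∀ (c : Fin 6 → F) (x : F), (ev q c x) ^ q ^ 2 = ev q (shiftc σ (shiftc σ c)) x := by
    intro c x; rw [sq, pow_mul, s1, s1]
  have s3 : ∀ (c : Fin 6 → F) (x : F), (ev q c x) ^ q ^ 3 = ev q (shiftc σ (shiftc σ (shiftc σ c))) x := by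
    intro c x; rw [pow_succ, pow_mul, s2, s1]
  have E1 : ∀ c : Fin 6 → F, ∑ x : Fˣ, (ev q c x / (x : F)) ^ 1 = - c 0 := by
    intro c
    rw [← T1 hq hF c 0]; simp
  have E2 : ∀ c : Fin 6 → F, ∑ x : Fˣ, (ev q c x / (x : F)) ^ (1 + q) = 
      - (c 0 * shiftc σ c 1 + c 1 * shiftc σ c 0) := by
    intro c
    rw [← T2 hq hF c (shiftc σ c) 1 (by decide)]
    refine Finset.sum_congr rfl fun x _ => ?_
    rw [div_pow, pow_add (ev q c x), s1]; simp
  have E3 : ∀ c : Fin 6 → F, ∑ x : Fˣ, (ev q c x / (x : F)) ^ (1 + q ^ 2) = 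
      - (c 0 * shiftc σ (shiftc σ c) 2 + c 2 * shiftc σ (shiftc σ c) 0) := by
    intro c
    rw [← T2 hq hF c (shiftc σ (shiftc σ c)) 2 (by decide)]
    refine Finset.sum_congr rfl fun x _ => ?_
    rw [div_pow, pow_add (ev q c x), s2]; simp
  have E4 : ∀ c : Fin 6 → F, ∑ x : Fˣ, (ev q c x / (x : F)) ^ (1 + q ^ 3) = 
      - (c 0 * shiftc σ (shiftc σ (shiftc σ c)) 3 + c 3 * shiftc σ (shiftc σ (shiftc σ c)) 0) := by
    intro c
    rw [← T2 hq hF c (shiftc σ (shiftc σ (shiftc σ c))) 3 (by decide)]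
    refine Finset.sum_congr rfl fun x _ => ?_
    rw [div_pow, pow_add (ev q c x), s3]; simp
  have E5 : ∀ c : Fin 6 → F, ∑ x : Fˣ, (ev q c x / (x : F)) ^ (1 + q + q ^ 2) =
      ∑ x : Fˣ, (ev q c x * ev q (shiftc σ c) x * ev q (shiftc σ (shiftc σ c)) x /
        (x : F) ^ (1 + q + q ^ 2)) := by
    intro c
    refine Finset.sum_congr rfl fun x _ => ?_
    rw [div_pow, pow_add (ev q c x), pow_add (ev q c x), s1, s2]; simp
  have r1 := S 1
  have r2 := S (1 + q)
  have r3 := S (1 + q ^ 2)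
  have r4 := S (1 + q ^ 3)
  have r5 := S (1 + q + q ^ 2)
  rw [E1, E1] at r1
  rw [E2, E2] at r2
  rw [E3, E3] at r3
  rw [E4, E4] at r4
  rw [E5, E5, T3 hq hF, T3 hq hF] at r5
  have c0 : c 0 = 0 := by simpa using r1
  simp [shiftc, c0] at r2 r3 r4 r5
  have hσδ : σ δ ≠ 0 := (map_ne_zero σ).2 hδ
  have n1 : c 1 ≠ 0 := by intro h; rw [h] at r2; simp at r2; exact hσδ (by simpa using r2.symm)
  have n5 : c 5 ≠ 0 := by intro h; rw [h] at r2; simp at r2; exact hσδ (by simpa using r2.symm)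
  rcases r3 with h2 | h4
  · simp [h2, n1] at r5
    exact ⟨c0, h2, r5, r2, r4⟩
  · simp [h4, n5] at r5
    exact ⟨c0, r5, h4, r2, r4⟩
end

section
variable {F : Type} [Field F]

theorem alg1 (σ : F →+* F) (h6 : ∀ x, σ (σ (σ (σ (σ (σ x))))) = x) (two : (2 : F) ≠ 0)
    (hU : ∀ (a0 a1 a2 a3 a4 a5 : F), (∀ x, a0 * x + a1 * σ x + a2 * σ (σ x) + a3 * σ (σ (σ x))
      + a4 * σ (σ (σ (σ x))) + a5 * σ (σ (σ (σ (σ x)))) = 0) →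
      a0 = 0 ∧ a1 = 0 ∧ a2 = 0 ∧ a3 = 0 ∧ a4 = 0 ∧ a5 = 0)
    (h0 h1 h2 h3 : F) (e1 : σ h0 = h1) (e2 : σ h1 = h2) (e3 : σ h2 = h3) (hh : h0 * h3 = -1)
    (f : F → F) (hf : ∀ x, f x = h1 / h0 * σ x - h2 / h0 * σ (σ x) + σ (σ (σ (σ x)))
      + σ (σ (σ (σ (σ x)))))
    (a b c d : F) (hΔ : a * d - b * c ≠ 0) (hA : ∀ z, ∃ y, a * y + b * f y = z)
    (φ : F → F) (hφ : ∀ l z, σ (l) = - l → φ (l * z) = - l * φ z) 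
    (hφA : ∀ x, φ (a * x + b * f x) = c * x + d * f x) :
    a * d + b * c = 0 ∧ a ^ 2 = b ^ 2 * (h1 + h2) ^ 2 := by
  have n0 : h0 ≠ 0 := by rintro rfl; simp at hh
  have n1 : h1 ≠ 0 := by rw [← e1]; exact (map_ne_zero σ).2 n0
  have n2 : h2 ≠ 0 := by rw [← e2]; exact (map_ne_zero σ).2 n1
  have h3e : h3 = -1 / h0 := by rw [eq_div_iff n0]; linear_combination hh
  obtain ⟨l, hl0, hl⟩ : ∃ l : F, l ≠ 0 ∧ σ l = - l := by
    by_contra hcon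
    push Not at hcon
    have := hU 1 (-1) 1 (-1) 1 (-1) (by
      intro x
      by_contra hne
      apply hcon _ hne
      simp only [map_add, map_mul, map_neg, map_one, h6]
      ring)
    exact one_ne_zero this.1
  set Δ := a * d - b * c with hΔdef
  -- the commuting map
  obtain ⟨α, hα⟩ : ∃ α, α = l * (a * d + b * c) / Δ := ⟨_, rfl⟩
  obtain ⟨β, hβ⟩ : ∃ β, β = l * (2 * b * d) / Δ := ⟨_, rfl⟩
  obtain ⟨γ, hγ⟩ : ∃ γ, γ = - l * (2 * a * c) / Δ := ⟨_, rfl⟩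
  have key : ∀ x, f (α * x + β * f x) = γ * x - α * f x := by
    intro x
    obtain ⟨y, hy⟩ := hA (l * (a * x + b * f x))
    have hy2 : c * y + d * f y = - l * (c * x + d * f x) := by
      rw [← hφA, ← hφA, hy, hφ _ _ hl]
    have hy3 : y = α * x + β * f x := by
      rw [hα, hβ]
      field_simp
      rw [hΔdef]
      linear_combination d * hy - b * hy2
    have hy4 : f y = γ * x - α * f x := by
      rw [hα, hγ]
      field_simp
      rw [hΔdef]
      linear_combination a * hy2 - c * hy
    rw [← hy3, hy4]
  obtain ⟨α1, hα1⟩ : ∃ y, σ α = y := ⟨_, rfl⟩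
  obtain ⟨α2, hα2⟩ : ∃ y, σ α1 = y := ⟨_, rfl⟩
  obtain ⟨α3, hα3⟩ : ∃ y, σ α2 = y := ⟨_, rfl⟩
  obtain ⟨α4, hα4⟩ : ∃ y, σ α3 = y := ⟨_, rfl⟩
  obtain ⟨α5, hα5⟩ : ∃ y, σ α4 = y := ⟨_, rfl⟩
  obtain ⟨β1, hβ1⟩ : ∃ y, σ β = y := ⟨_, rfl⟩
  obtain ⟨β2, hβ2⟩ : ∃ y, σ β1 = y := ⟨_, rfl⟩
  obtain ⟨β3, hβ3⟩ : ∃ y, σ β2 = y := ⟨_, rfl⟩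
  obtain ⟨β4, hβ4⟩ : ∃ y, σ β3 = y := ⟨_, rfl⟩
  obtain ⟨β5, hβ5⟩ : ∃ y, σ β4 = y := ⟨_, rfl⟩
  have hα6 : σ α5 = α := by rw [← hα5, ← hα4, ← hα3, ← hα2, ← hα1, h6]
  have hβ6 : σ β5 = β := by rw [← hβ5, ← hβ4, ← hβ3, ← hβ2, ← hβ1, h6]
  obtain ⟨m0, m1, m2, m3, m4, m5⟩ := hU 
    (h1 / h0 * β1 - h2 / h0 * β2 + h0 * h1 * β4 - h0 * h2 * β5 - γ)
    (h1 / h0 * α1 - h2 / h0 * β2 + h1 * h2 * β5 + α * (h1 / h0))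
    (-(h2 / h0) * α2 + h2 / h0 * β1 + β4 - α * (h2 / h0))
    ((β1 + β2) / h0 ^ 2 + β4 + β5)
    (α4 - β2 / (h0 * h1) + β5 + α)
    (α5 + h1 / h0 * β1 + h1 / h2 * β4 + α) (by
      intro x
      have k := key x
      rw [hf (α * x + β * f x)] at k
      simp only [hf, map_add, map_sub, map_mul, map_div₀, map_neg, map_one, h6, e1, e2, e3, h3e, hα1, hα2, hα3, hα4, hα5, hβ1, hβ2, hβ3, hβ4, hβ5] at k
      rw [← sub_eq_zero] at k
      rw [← k]
      field_simp
      ring)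
  have x1 : α1 = -α + h2 / h1 * β2 - h0 * h2 * β5 := by
    field_simp at m1 ⊢; linear_combination m1
  have x5 : α5 = -α - h1 / h0 * β1 - h1 / h2 * β4 := by linear_combination m5
  have x2 : α2 = -α + β1 + h0 / h2 * β4 := by
    field_simp at m2 ⊢; linear_combination -m2
  have y5 := congrArg σ x5
  simp only [map_add, map_sub, map_mul, map_div₀, map_neg, map_one, e1, e2, e3, h3e, hα1, hα6, hβ1, hβ2, hβ5] at y5
  have X : β2 = h0 * h1 * β5 := by
    have hz : h2 / (-1 / h0) = - (h2 * h0) := by field_simp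
    rw [hz] at y5
    have h4 : 2 * (h2 / h1 * β2 - h0 * h2 * β5) = 0 := by linear_combination y5 - x1
    have : 2 * (h2 * h1) * (β2 - h0 * h1 * β5) = 0 := by
      field_simp at h4
      linear_combination h1 * h4
    have := (mul_eq_zero.1 this).resolve_left (by simp [two, n1, n2])
    linear_combination this
  have Y : β1 = -(h0 / h2) * β4 := by
    apply σ.injective
    simp only [map_add, map_sub, map_mul, map_div₀, map_neg, map_one, e1, e2, e3, h3e, hβ2, hβ5]
    rw [X]; field_simp
  have a1 : α1 = -α := by rw [x1, X]; field_simp; ring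
  have a2 : α2 = -α := by rw [x2, Y]; field_simp; ring
  have a0 : α = 0 := by
    have := congrArg σ a1
    rw [hα2, map_neg, hα1, a2, a1] at this
    have : 2 * α = 0 := by linear_combination -this
    exact (mul_eq_zero.1 this).resolve_left two
  have ad : a * d + b * c = 0 := by
    rw [a0] at hα
    have := hα.symm
    simpa [hΔ, hl0] using this
  refine ⟨ad, ?_⟩
  -- relation on β
  have B1 : β4 * (h0 * h2 - 1) + β5 * (h0 + h1) * h2 = 0 := by
    rw [Y, X] at m3
    field_simp at m3
    linear_combination m3
  have B2 : β5 * (h1 + h0) + β * (h1 + h2) = 0 := by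
    have := congrArg σ B1
    simp only [map_add, map_sub, map_mul, map_zero, map_one, e1, e2, e3, h3e, hβ5, hβ6] at this
    field_simp at this
    linear_combination (-1) * this
  have G : γ = β * (h1 + h2) ^ 2 := by
    rw [Y, X] at m0
    field_simp at m0
    apply mul_left_cancel₀ n2
    linear_combination (-1) * m0 + h1 * B1 - (h1 * h2 + h2 ^ 2) * B2
  have hd : a * d ≠ 0 := by
    intro h
    apply hΔ
    rw [hΔdef]; linear_combination 2 * h - ad
  have G2 : 2 * l * d * (b * a ^ 2 - b * (b ^ 2 * (h1 + h2) ^ 2)) = 0 := by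
    rw [hγ, hβ] at G
    rw [div_mul_eq_mul_div, div_left_inj' hΔ] at G
    linear_combination b * (b * G + 2 * l * a * ad)
  have nd : d ≠ 0 := right_ne_zero_of_mul hd
  have nb : b ≠ 0 := by
    rintro rfl
    apply hd; linear_combination ad
  have := (mul_eq_zero.1 G2).resolve_left (by simp [two, hl0, nd])
  have : b * (a ^ 2 - b ^ 2 * (h1 + h2) ^ 2) = 0 := by linear_combination this
  have := (mul_eq_zero.1 this).resolve_left nb
  linear_combination this
end

section
variable {F : Type} [Field F]

theorem alg2 (σ : F →+* F) (h6 : ∀ x, σ (σ (σ (σ (σ (σ x))))) = x) (two : (2 : F) ≠ 0)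
    (hU : ∀ (a0 a1 a2 a3 a4 a5 : F), (∀ x, a0 * x + a1 * σ x + a2 * σ (σ x) + a3 * σ (σ (σ x))
      + a4 * σ (σ (σ (σ x))) + a5 * σ (σ (σ (σ (σ x)))) = 0) →
      a0 = 0 ∧ a1 = 0 ∧ a2 = 0 ∧ a3 = 0 ∧ a4 = 0 ∧ a5 = 0)
    (h0 h1 h2 h3 : F) (e1 : σ h0 = h1) (e2 : σ h1 = h2) (e3 : σ h2 = h3) (hh : h0 * h3 = -1)
    (hne : h2 ≠ h0)
    (f : F → F) (hf : ∀ x, f x = h1 / h0 * σ x - h2 / h0 * σ (σ x) + σ (σ (σ (σ x)))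
      + σ (σ (σ (σ (σ x)))))
    (a b c d : F) (nb : b ≠ 0) (ha : a = b * (h1 + h2)) (hc : c = - d * (h1 + h2))
    (c1 c3 c5 δ : F) (hδ : δ ^ 2 + δ = 1)
    (hφA : ∀ x, c1 * σ (a * x + b * f x) + c3 * σ (σ (σ (a * x + b * f x))) +
      c5 * σ (σ (σ (σ (σ (a * x + b * f x))))) = c * x + d * f x)
    (r15 : c1 * σ c5 = σ δ) (r33 : c3 * σ (σ (σ c3)) = 1) : False := by
  have n0 : h0 ≠ 0 := by rintro rfl; simp at hh
  have n1 : h1 ≠ 0 := by rw [← e1]; exact (map_ne_zero σ).2 n0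
  have n2 : h2 ≠ 0 := by rw [← e2]; exact (map_ne_zero σ).2 n1
  have h3e : h3 = -1 / h0 := by rw [eq_div_iff n0]; linear_combination hh
  have nδ : δ ≠ 0 := by rintro rfl; simp at hδ
  have hδ2 : σ (σ δ) = δ := by
    have h := congrArg σ hδ
    simp only [map_add, map_pow, map_one] at h
    have : (σ δ - δ) * (σ δ + δ + 1) = 0 := by linear_combination h - hδ
    rcases mul_eq_zero.1 this with h' | h'
    · have h'' : σ δ = δ := by linear_combination h'
      rw [h'', h'']
    · have h'' : σ δ = -1 - δ := by linear_combination h'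
      rw [h'']; simp only [map_sub, map_neg, map_one, h'']; ring
  obtain ⟨b1, hb1⟩ : ∃ y, σ b = y := ⟨_, rfl⟩
  obtain ⟨b2, hb2⟩ : ∃ y, σ b1 = y := ⟨_, rfl⟩
  obtain ⟨b3, hb3⟩ : ∃ y, σ b2 = y := ⟨_, rfl⟩
  obtain ⟨b4, hb4⟩ : ∃ y, σ b3 = y := ⟨_, rfl⟩
  obtain ⟨b5, hb5⟩ : ∃ y, σ b4 = y := ⟨_, rfl⟩
  have hb6 : σ b5 = b := by rw [← hb5, ← hb4, ← hb3, ← hb2, ← hb1, h6]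
  have nb1 : b1 ≠ 0 := by rw [← hb1]; exact (map_ne_zero σ).2 nb
  have nb2 : b2 ≠ 0 := by rw [← hb2]; exact (map_ne_zero σ).2 nb1
  have nb3 : b3 ≠ 0 := by rw [← hb3]; exact (map_ne_zero σ).2 nb2
  have nb4 : b4 ≠ 0 := by rw [← hb4]; exact (map_ne_zero σ).2 nb3
  have nb5 : b5 ≠ 0 := by rw [← hb5]; exact (map_ne_zero σ).2 nb4
  obtain ⟨y1, hy1⟩ : ∃ y, y = c1 * b1 := ⟨_, rfl⟩
  obtain ⟨y3, hy3⟩ : ∃ y, y = c3 * b3 := ⟨_, rfl⟩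
  obtain ⟨y5, hy5⟩ : ∃ y, y = c5 * b5 := ⟨_, rfl⟩
  obtain ⟨m0, m1, m2, m3, m4, m5⟩ := hU 
    (y1 - h0 * h2 * y5 - c)
    (c1 * σ a + y3 + y5 * h1 * h2 - d * h1 / h0)
    (y1 * (h2 / h1) + y3 + d * h2 / h0)
    (y1 / (h0 * h1) + c3 * σ (σ (σ a)) + y5)
    (y3 * (h0 / h1) + y5 - d)
    (y1 - y3 * (h0 / h2) + c5 * σ (σ (σ (σ (σ a)))) - d) (by
      intro x
      have k := hφA x
      simp only [hf, map_add, map_sub, map_mul, map_div₀, map_neg, map_one, h6, e1, e2, e3, h3e, hb1, hb2, hb3, hb4, hb5] at k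
      rw [← sub_eq_zero] at k
      rw [← k, hy1, hy3, hy5]
      field_simp
      ring)
  have ns : h1 + h0 * h2 ≠ 0 := by
    intro h
    have h' := congrArg σ h
    simp only [map_add, map_mul, map_zero, e1, e2, e3] at h'
    have : 2 * h1 = 0 := by linear_combination h - h0 * h' + h1 * hh
    exact n1 ((mul_eq_zero.1 this).resolve_left two)
  have ns' : h1 - h0 * h2 ≠ 0 := by
    intro h
    have h' := congrArg σ h
    simp only [map_sub, map_mul, map_zero, e1, e2, e3] at h'
    have : 2 * h1 = 0 := by linear_combination h + h0 * h' + h1 * hh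
    exact n1 ((mul_eq_zero.1 this).resolve_left two)
  obtain ⟨s, hs⟩ : ∃ s, s = h1 + h0 * h2 := ⟨_, rfl⟩
  rw [← hs] at ns
  rw [hc] at m0
  have z1 : s * y1 = - d * h1 * (h1 + h2) := by
    apply mul_left_cancel₀ ns'
    field_simp at m2 m4
    rw [hs]
    linear_combination h1 ^ 2 * m0 + h0 * h1 * h2 * m4 - h0 * h2 * m2
  have z3 : s * h0 * y3 = - d * h1 * h2 * (1 - h0) := by
    apply mul_left_cancel₀ n1
    field_simp at m2
    rw [hs]
    rw [hs] at z1
    linear_combination (h1 + h0 * h2) * m2 - h2 * h0 * z1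
  have z5 : s * y5 = d * (h1 + h2) := by
    apply mul_left_cancel₀ n1
    field_simp at m4
    rw [hs]
    rw [hs] at z3
    linear_combination (h1 + h0 * h2) * m4 - z3
  obtain ⟨k, hk⟩ : ∃ k, k = d / (s * b) := ⟨_, rfl⟩
  have w1 : c1 = - d * h1 * (h1 + h2) / (s * b1) := by
    field_simp; linear_combination z1 - s * hy1
  have w3 : c3 = - d * h1 * h2 * (1 - h0) / (s * h0 * b3) := by
    field_simp; linear_combination z3 - s * h0 * hy3
  have w5 : c5 = d * (h1 + h2) / (s * b5) := by
    field_simp; linear_combination z5 - s * hy5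
  obtain ⟨k1, hk1⟩ : ∃ y, σ k = y := ⟨_, rfl⟩
  obtain ⟨k2, hk2⟩ : ∃ y, σ k1 = y := ⟨_, rfl⟩
  obtain ⟨k3, hk3⟩ : ∃ y, σ k2 = y := ⟨_, rfl⟩
  obtain ⟨D, hD⟩ : ∃ y, σ δ = y := ⟨_, rfl⟩
  rw [hD] at hδ2
  have R1 : - (h1 * (h1 + h2) * (h2 + h3)) * (k * k1) = D := by
    rw [← hD, ← r15, w1, w5, ← hk1, hk]
    simp only [map_add, map_mul, map_div₀, e1, e2, e3, hb1, hb6]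
    have : σ s ≠ 0 := (map_ne_zero σ).2 ns
    field_simp
  have R3 : k * k3 * (h0 ^ 2 - 1) = h0 := by
    suffices aux : k * k3 * (h0 ^ 2 - 1) = h0 * (c3 * σ (σ (σ c3))) by
      rw [aux, r33, mul_one]
    rw [w3, ← hk3, ← hk2, ← hk1, hk]
    simp only [map_add, map_sub, map_neg, map_one, map_mul, map_div₀, e1, e2, e3, h3e, hb1, hb2, hb3, hb4, hb5, hb6]
    have : σ (σ (σ s)) ≠ 0 := (map_ne_zero σ).2 ((map_ne_zero σ).2 ((map_ne_zero σ).2 ns))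
    field_simp
    ring
  have R1' := congrArg σ R1
  simp only [map_add, map_mul, map_neg, e1, e2, e3, hk1, hk2, hδ2] at R1'
  have R1'' := congrArg σ R1'
  simp only [map_add, map_mul, map_neg, e1, e2, e3, hk1, hk2, hk3, hD] at R1''
  have star : D ^ 2 * h2 ^ 2 * (h0 ^ 2 - 1) = - δ * (h1 + h2) ^ 2 := by
    have q1 : D ^ 2 * h2 = - δ * h1 * h3 * (h1 + h2) * (σ h3 + σ (σ h3)) * (k * k3) := by
      rw [← R1']
      rw [sq]
      nth_rw 1 [← R1]
      rw [← R1'']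
      ring
    have q2 : σ h3 = -1 / h1 := by rw [h3e]; simp [e1]
    have q3 : σ (σ h3) = -1 / h2 := by rw [q2]; simp [e2]
    rw [q3, q2, h3e] at q1
    field_simp at q1
    apply mul_left_cancel₀ n0
    linear_combination (h0 ^ 2 - 1) * q1 - δ * (h1 + h2) ^ 2 * R3
  -- quadratic equation over the fixed field of σ²
  obtain ⟨r, hr⟩ : ∃ r, r = h0 * h2 / h1 := ⟨_, rfl⟩
  have nr : r ≠ 0 := by rw [hr]; exact div_ne_zero (mul_ne_zero n0 n2) n1
  have hr2 : σ (σ r) = r := by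
    rw [hr]
    simp only [map_mul, map_div₀, e1, e2, e3, h3e, map_neg, map_one]
    field_simp
  have hD2 : σ (σ D) = D := by rw [hδ2, hD]
  have hδ4 : σ (σ δ) = δ := by rw [hD, hδ2]
  have Q0 : (δ + D ^ 2 * r ^ 2) * h0 ^ 2 + 2 * r * δ * h0 + (δ * r ^ 2 - D ^ 2 * r ^ 2) = 0 := by
    rw [hr]
    field_simp
    linear_combination h0 ^ 2 * star
  obtain ⟨h4, e4⟩ : ∃ y, σ h3 = y := ⟨_, rfl⟩
  have Q2 : (δ + D ^ 2 * r ^ 2) * h2 ^ 2 + 2 * r * δ * h2 + (δ * r ^ 2 - D ^ 2 * r ^ 2) = 0 := by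
    have := congrArg (fun x => σ (σ x)) Q0
    simpa only [map_add, map_sub, map_mul, map_pow, map_zero, map_ofNat, e1, e2, hr2, hD2, hδ4] using this
  have L0 : (δ + D ^ 2 * r ^ 2) * (h0 + h2) + 2 * r * δ = 0 := by
    have : (h2 - h0) * ((δ + D ^ 2 * r ^ 2) * (h0 + h2) + 2 * r * δ) = 0 := by
      linear_combination Q2 - Q0
    exact (mul_eq_zero.1 this).resolve_left (sub_ne_zero.2 hne)
  have L2 : (δ + D ^ 2 * r ^ 2) * (h2 + h4) + 2 * r * δ = 0 := by
    have := congrArg (fun x => σ (σ x)) L0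
    simpa only [map_add, map_sub, map_mul, map_pow, map_zero, map_ofNat, e1, e2, e3, e4, hr2, hD2, hδ4] using this
  have L : (δ + D ^ 2 * r ^ 2) * (h0 - h4) = 0 := by linear_combination L0 - L2
  rcases mul_eq_zero.1 L with h | h
  · rw [h] at L0
    simp [two, nr, nδ] at L0
  · have h40 : h4 = h0 := by linear_combination -h
    apply hne
    have := h6 h0
    rw [e1, e2, e3, e4, h40, e1, e2] at this
    exact this
end

theorem mem_linearSet {F : Type} [Field F] (f : F → F) (v : F × F) (hv : v ≠ 0) :
    Projectivization.mk F v hv ∈ linearSet f ↔ ∃ x u : F, x ≠ 0 ∧ u ≠ 0 ∧ v = (u * x, u * f x) := by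
  constructor
  · rintro ⟨x, hx, h⟩
    obtain ⟨u, hu⟩ := (Projectivization.mk_eq_mk_iff' F _ _ _ _).1 h
    refine ⟨x, u, hx, ?_, ?_⟩
    · rintro rfl
      apply hv; rw [← hu]; simp
    · rw [← hu]; simp
  · rintro ⟨x, u, hx, hu, h⟩
    refine ⟨x, hx, ?_⟩
    rw [Projectivization.mk_eq_mk_iff']
    exact ⟨u, by rw [h]; simp⟩

theorem core {F : Type} [Field F] [Fintype F] [DecidableEq F] {q : ℕ} (hq : 3 ≤ q) 
    (hF : Fintype.card F = q ^ 6) (p : ℕ) [Fact p.Prime] [CharP F p] (two : (2 : F) ≠ 0)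
    (σ : F →+* F) (hσ : ∀ x, σ x = x ^ q)
    (h6 : ∀ x, σ (σ (σ (σ (σ (σ x))))) = x)
    (h : F) (hh : h * σ (σ (σ h)) = -1) (hne : σ (σ h) ≠ h)
    (f : F → F) (hf : ∀ x, f x = σ h / h * σ x - σ (σ h) / h * σ (σ x) + σ (σ (σ (σ x)))
      + σ (σ (σ (σ (σ x)))))
    (a b c d δ : F) (hΔ : a * d - b * c ≠ 0) (hδ : δ ^ 2 + δ = 1)
    (H1 : ∀ x, x ≠ 0 → ∃ z, z ≠ 0 ∧ a * x + b * f x ≠ 0 ∧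
      (c * x + d * f x) / (a * x + b * f x) = ev q ![0, 1, 0, 1, 0, δ] z / z)
    (H2 : ∀ z, z ≠ 0 → ∃ x, x ≠ 0 ∧
      (c * x + d * f x) / (a * x + b * f x) = ev q ![0, 1, 0, 1, 0, δ] z / z) : False := by
  have nδ : δ ≠ 0 := by rintro rfl; simp at hδ
  let C : F → F → Fin 6 → F := fun a b => ![a, b * (σ h / h), - b * (σ (σ h) / h), 0, b, b]
  have hC : ∀ a b x, a * x + b * f x = ev q (C a b) x := by
    intro a b x
    rw [ev_eq q σ hσ, hf]; simp [C]; ring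
  have hAb : Function.Bijective (ev q (C a b)) := by
    rw [Finite.injective_iff_bijective.symm]
    have : Function.Injective (evHom q σ hσ (C a b)) := by
      rw [injective_iff_map_eq_zero]
      intro x hx
      by_contra hx0
      obtain ⟨z, -, h2, -⟩ := H1 x hx0
      apply h2
      rw [hC]; exact hx
    exact this
  obtain ⟨c', hc'⟩ := exists_left_inv σ hσ h6 ⟨_, fun x => rfl⟩ hAb
  obtain ⟨e, he⟩ := IsQ.comp σ hσ h6 (⟨C c d, fun x => rfl⟩ : IsQ q (ev q (C c d))) 
    (⟨c', fun x => rfl⟩ : IsQ q (ev q c'))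
  have heA : ∀ x, ev q e (a * x + b * f x) = c * x + d * f x := by
    intro x
    rw [← he, hC a b, hC c d, Function.comp, hc']
  have him : Finset.univ.image (fun x : Fˣ => ev q e x / (x : F)) = 
      Finset.univ.image (fun x : Fˣ => ev q ![0, 1, 0, 1, 0, δ] x / (x : F)) := by
    ext m
    simp only [Finset.mem_image, Finset.mem_univ, true_and]
    constructor
    · rintro ⟨y, rfl⟩
      obtain ⟨x, hx⟩ := hAb.2 (y : F)
      rw [← hC] at hx
      have hx0 : x ≠ 0 := by
        rintro rfl
        apply y.ne_zero
        rw [← hx, hC]; exact map_zero (evHom q σ hσ (C a b))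
      obtain ⟨z, hz, -, h3⟩ := H1 x hx0
      exact ⟨Units.mk0 z hz, by rw [← hx, heA, h3]; rfl⟩
    · rintro ⟨z, rfl⟩
      obtain ⟨x, hx, h3⟩ := H2 z z.ne_zero
      obtain ⟨_, _, h4, _⟩ := H1 x hx
      exact ⟨Units.mk0 _ h4, by rw [← h3, Units.val_mk0, heA]⟩
  obtain ⟨z0, z2, z4, r15, r33⟩ := coeffs hq hF p σ hσ h6 e δ nδ him
  have hev : ∀ x, ev q e x = e 1 * σ x + e 3 * σ (σ (σ x)) + e 5 * σ (σ (σ (σ (σ x)))) := by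
    intro x; rw [ev_eq q σ hσ, z0, z2, z4]; ring
  have hU := sigma_unique hq hF σ hσ
  have hA : ∀ z, ∃ y, a * y + b * f y = z := by
    intro z
    obtain ⟨y, hy⟩ := hAb.2 z
    exact ⟨y, by rw [hC, hy]⟩
  obtain ⟨ad, sq⟩ := alg1 σ h6 two hU h _ _ _ rfl rfl rfl hh f hf a b c d hΔ hA (ev q e)
    (by
      intro l z hl
      rw [hev, hev]
      simp only [map_mul, map_neg, hl]
      ring) heA
  have had : a * d ≠ 0 := by
    intro h'
    apply hΔ
    linear_combination 2 * h' - ad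
  have nb : b ≠ 0 := by
    rintro rfl
    apply had; linear_combination ad
  have heA' : ∀ x, e 1 * σ (a * x + b * f x) + e 3 * σ (σ (σ (a * x + b * f x))) +
      e 5 * σ (σ (σ (σ (σ (a * x + b * f x))))) = c * x + d * f x := by
    intro x; rw [← heA, hev]
  have : (a - b * (σ h + σ (σ h))) * (a + b * (σ h + σ (σ h))) = 0 := by linear_combination sq
  rcases mul_eq_zero.1 this with h' | h'
  · have ha : a = b * (σ h + σ (σ h)) := by linear_combination h'
    refine alg2 σ h6 two hU h _ _ _ rfl rfl rfl hh hne f hf a b c d nb ha ?_ _ _ _ δ hδ heA' r15 r33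
    apply mul_left_cancel₀ nb
    linear_combination ad - d * h'
  · have ha : a = b * (σ (-h) + σ (σ (-h))) := by simp only [map_neg]; linear_combination h'
    refine alg2 σ h6 two hU (-h) _ _ _ rfl rfl rfl (by simpa using hh) (by simpa using hne) f ?_ a b c d nb ha ?_ _ _ _ δ hδ heA' r15 r33
    · intro x; rw [hf]; simp
    apply mul_left_cancel₀ nb
    simp only [map_neg]
    linear_combination ad - d * h'

/-- Let `q` be an odd prime power, `F` a finite field with `q^6` elements,
and `h ∈ F` with `h^(q^3+1) = −1` and `h^(q^2) ≠ h` (i.e. `h ∉ F_{q^2}`). Then `𝓛_h` is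
not PΓL-equivalent to `L^4_δ` for any `δ ∈ F` with `δ^2 + δ = 1`. -/
theorem stmt12 (q : ℕ) (hq : IsPrimePow q) (hodd : Odd q)
    (F : Type) [Field F] [Fintype F] (hF : Fintype.card F = q ^ 6)
    (h : F) (hh : h ^ (q ^ 3 + 1) = -1) (hq2 : h ^ (q ^ 2) ≠ h) :
    ∀ δ : F, δ ^ 2 + δ = 1 →
      ¬ IsPGammaLEquiv (linearSet (fpol q h))
          (linearSet (fun x : F => x ^ q + x ^ (q ^ 3) + δ * x ^ (q ^ 5))) := by
  classical
  rintro δ hδ ⟨ρ, g, gadd, gsmul, gmem⟩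
  obtain ⟨p, k, hp, hk, hpk⟩ := hq
  have hp' : p.Prime := hp.nat_prime
  have : Fact p.Prime := ⟨hp'⟩
  have hcp : CharP F p := charP_of_card_eq_prime_pow (f := k * 6) (by rw [hF, ← hpk, pow_mul])
  have hq3 : 3 ≤ q := by
    have h1 : 1 < q := by rw [← hpk]; exact Nat.one_lt_pow hk.ne' hp'.one_lt
    rcases hodd with ⟨m, hm⟩
    omega
  have two : (2 : F) ≠ 0 := by
    intro h2
    have : p ∣ 2 := (CharP.cast_eq_zero_iff F p 2).1 (by exact_mod_cast h2)
    have hp2 : p = 2 := (Nat.prime_dvd_prime_iff_eq hp' Nat.prime_two).1 this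
    have : Even q := by rw [← hpk, hp2]; exact (even_two).pow_of_ne_zero hk.ne'
    exact (Nat.not_even_iff_odd.2 hodd) this
  obtain ⟨σ, hσ⟩ : ∃ σ : F →+* F, ∀ x, σ x = x ^ q :=
    ⟨iterateFrobenius F p k, fun x => by rw [iterateFrobenius_def, hpk]⟩
  have h6 : ∀ x, σ (σ (σ (σ (σ (σ x))))) = x := by
    intro x
    simp only [hσ, ← pow_mul]
    calc _ = x ^ (q ^ 6) := by ring_nf
      _ = x := by rw [← hF]; exact FiniteField.pow_card x
  have p2 : ∀ x : F, x ^ (q ^ 2) = σ (σ x) := by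
    intro x; simp only [hσ, ← pow_mul]; ring_nf
  have p3 : ∀ x : F, x ^ (q ^ 3) = σ (σ (σ x)) := by
    intro x; simp only [hσ, ← pow_mul]; ring_nf
  have p4 : ∀ x : F, x ^ (q ^ 4) = σ (σ (σ (σ x))) := by
    intro x; simp only [hσ, ← pow_mul]; ring_nf
  have p5 : ∀ x : F, x ^ (q ^ 5) = σ (σ (σ (σ (σ x)))) := by
    intro x; simp only [hσ, ← pow_mul]; ring_nf
  have hρσ : ∀ x, ρ (σ x) = σ (ρ x) := by intro x; simp [hσ]
  rw [pow_succ, p3] at hh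
  rw [p2] at hq2
  have n0 : h ≠ 0 := by rintro rfl; simp at hh
  have hfp : ∀ x, fpol q h x = σ h / h * σ x - σ (σ h) / h * σ (σ x) + σ (σ (σ (σ x)))
      + σ (σ (σ (σ (σ x)))) := by
    intro x
    have e1 : h ^ (q - 1) = σ h / h := by
      rw [eq_div_iff n0, ← pow_succ, hσ]; congr 1; omega
    have e2 : h ^ (q ^ 2 - 1) = σ (σ h) / h := by
      have : 0 < q ^ 2 := by positivity
      rw [eq_div_iff n0, ← pow_succ, ← p2]; congr 1; omega
    rw [fpol, e1, e2, p2, p4, p5, hσ x]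
  let f : F → F := fun x => σ (ρ h) / (ρ h) * σ x - σ (σ (ρ h)) / (ρ h) * σ (σ x) + σ (σ (σ (σ x)))
      + σ (σ (σ (σ (σ x))))
  have hρf : ∀ x, ρ (fpol q h x) = f (ρ x) := by
    intro x
    rw [hfp]
    simp only [map_add, map_sub, map_mul, map_div₀, hρσ, f]
  have h4 : ∀ x : F, x ^ q + x ^ (q ^ 3) + δ * x ^ (q ^ 5) = ev q ![0, 1, 0, 1, 0, δ] x := by
    intro x
    rw [ev_eq q σ hσ, p3, p5, ← hσ]; simp
  simp only [h4] at gmem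
  obtain ⟨⟨a, c⟩, hac⟩ : ∃ w, g (1, 0) = w := ⟨_, rfl⟩
  obtain ⟨⟨b, d⟩, hbd⟩ : ∃ w, g (0, 1) = w := ⟨_, rfl⟩
  have hg : ∀ x y, g (x, y) = (a * ρ x + b * ρ y, c * ρ x + d * ρ y) := by
    intro x y
    have : ((x, y) : F × F) = x • (1, 0) + y • (0, 1) := by simp
    rw [this, gadd, gsmul, gsmul, hac, hbd]
    ext <;> simp <;> ring
  have g0 : g 0 = 0 := by
    have := hg 0 0
    simp only [map_zero, mul_zero, add_zero] at this
    exact this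
  have gne : ∀ v, v ≠ 0 → g v ≠ 0 := by
    intro v hv h'
    exact hv (g.injective (h'.trans g0.symm))
  have hΔ : a * d - b * c ≠ 0 := by
    intro hΔ
    have k1 : g (ρ.symm d, - ρ.symm c) = 0 := by
      rw [hg]; ext <;> simp
      · linear_combination hΔ
      · ring
    have k2 : g (ρ.symm b, - ρ.symm a) = 0 := by
      rw [hg]; ext <;> simp
      · ring
      · linear_combination -hΔ
    have k1' := g.injective (k1.trans g0.symm)
    have k2' := g.injective (k2.trans g0.symm)
    simp at k1' k2'
    have := gne (1, 0) (by simp)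
    apply this
    rw [hac, k1'.2, k2'.2]; rfl
  refine core hq3 hF p two σ hσ h6 (ρ h) ?_ ?_ f (fun x => rfl) a b c d δ hΔ hδ ?_ ?_
  · rw [← hρσ, ← hρσ, ← hρσ, ← map_mul, mul_comm, hh]; simp
  · rw [← hρσ, ← hρσ]
    intro h'; exact hq2 (ρ.injective h')
  · intro x hx
    obtain ⟨X, rfl⟩ := ρ.surjective x
    have hX : X ≠ 0 := by rintro rfl; simp at hx
    have hv : ((X, fpol q h X) : F × F) ≠ 0 := by simp [hX]
    have m1 : Projectivization.mk F (X, fpol q h X) hv ∈ linearSet (fpol q h) :=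
      (mem_linearSet _ _ _).2 ⟨X, 1, hX, one_ne_zero, by simp⟩
    have m2 := (gmem _ hv (gne _ hv)).1 m1
    obtain ⟨z, u, hz, hu, he⟩ := (mem_linearSet _ _ _).1 m2
    rw [hg, hρf] at he
    simp only [Prod.mk.injEq] at he
    refine ⟨z, hz, ?_, ?_⟩
    · rw [he.1]; exact mul_ne_zero hu hz
    · rw [he.1, he.2, mul_div_mul_left _ _ hu]
  · intro z hz
    obtain ⟨v, hv⟩ := g.surjective (z, ev q ![0, 1, 0, 1, 0, δ] z)
    have hv0 : v ≠ 0 := by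
      rintro rfl
      rw [g0] at hv
      exact hz (congrArg Prod.fst hv).symm
    have m2 := (gmem v hv0 (gne _ hv0)).2 ((mem_linearSet _ _ _).2 ⟨z, 1, hz, one_ne_zero, by rw [hv]; simp⟩)
    obtain ⟨x, u, hx, hu, he⟩ := (mem_linearSet _ _ _).1 m2
    refine ⟨ρ x, by simpa using hx, ?_⟩
    rw [he, hg] at hv
    simp only [map_mul, hρf, Prod.mk.injEq] at hv
    have hu' : ρ u ≠ 0 := by simpa using hu
    rw [← hv.2, ← hv.1, ← mul_div_mul_left _ _ hu']
    congr 1 <;> ring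
end

section
/- Let q be an odd prime power, F a finite field with q^6 elements, and h ∈ F with h^(q^3+1) = −1 and h^(q^2) = h (so h^(q+1) = −1 and h ≠ 0). Define g : F → F by g(x) = (h^(−1) − 1)·x^q + x^(q^3) + (h − 1)·x^(q^5). Then the invertible F-linear map (u, v) ↦ (a·u + b·v, c·u + d·v) with a = −h + h^(−1), b = 1, c = h^(−1) − 1 − h^3 + h^2, d = h − h^2 − 1 maps the F_q-subspace U_h = {(x, f_h(x)) : x ∈ F} of F × F onto U_g = {(x, g(x)) : x ∈ F}; in particular, 𝓛_h is PΓL-equivalent to the linear set L_g defined by the trinomial g. -/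
/-- Let `q` be an odd prime power, `F` a finite field with `q^6` elements,
and `h ∈ F` with `h^(q^3+1) = −1` and `h^(q^2) = h`. Define
`g(x) = (h⁻¹ − 1)·x^q + x^(q^3) + (h − 1)·x^(q^5)`. Then the invertible `F`-linear map
`(u,v) ↦ (a·u + b·v, c·u + d·v)` with `a = −h + h⁻¹`, `b = 1`, `c = h⁻¹ − 1 − h^3 + h^2`,
`d = h − h^2 − 1` maps `U_h = {(x, f_h x) : x ∈ F}` onto `U_g = {(x, g x) : x ∈ F}`;
in particular `𝓛_h` is PΓL-equivalent to the linear set `L_g` defined by the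
trinomial `g`. -/
theorem stmt14 (q : ℕ) (hq : IsPrimePow q) (hodd : Odd q)
    (F : Type) [Field F] [Fintype F] (hF : Fintype.card F = q ^ 6)
    (h : F) (hh : h ^ (q ^ 3 + 1) = -1) (hq2 : h ^ (q ^ 2) = h)
    (a b c d : F) (ha : a = -h + h⁻¹) (hb : b = 1)
    (hc : c = h⁻¹ - 1 - h ^ 3 + h ^ 2) (hd : d = h - h ^ 2 - 1)
    (g : F → F)
    (hg : ∀ x : F, g x = (h⁻¹ - 1) * x ^ q + x ^ (q ^ 3) + (h - 1) * x ^ (q ^ 5)) :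
    a * d - b * c ≠ 0 ∧
    (fun p : F × F => (a * p.1 + b * p.2, c * p.1 + d * p.2)) ''
        {p : F × F | ∃ x : F, p = (x, fpol q h x)} =
      {p : F × F | ∃ x : F, p = (x, g x)} ∧
    IsPGammaLEquiv (linearSet (fpol q h)) (linearSet g) := by
  have hq6 : ∀ x : F, x ^ (q ^ 6) = x := fun x => hF ▸ FiniteField.pow_card x
  obtain ⟨φ, hφ⟩ : ∃ φ : F →+* F, ∀ x, φ x = x ^ q := by
    obtain ⟨p, k, hp, hk, rfl⟩ := hq
    have hp' : p.Prime := hp.nat_prime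
    obtain ⟨r, hr⟩ := CharP.exists F
    obtain ⟨n, hrp, hcard⟩ := FiniteField.card F r
    have : r ∣ p := by
      have h1 : r ∣ (p ^ k) ^ 6 := by
        rw [← hF, hcard]; exact dvd_pow_self r n.pos.ne'
      exact hrp.dvd_of_dvd_pow (hrp.dvd_of_dvd_pow h1)
    have hrp2 : r = p := (Nat.prime_dvd_prime_iff_eq hrp hp').1 this
    subst hrp2
    haveI : Fact r.Prime := ⟨hp'⟩
    exact ⟨iterateFrobenius F r k, fun x => iterateFrobenius_def r k x⟩
  have e2 : ∀ x : F, x ^ (q ^ 2) = φ (φ x) := fun x => by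
    rw [hφ, hφ, ← pow_mul]; congr 1; ring
  have e3 : ∀ x : F, x ^ (q ^ 3) = φ (φ (φ x)) := fun x => by
    rw [hφ, hφ, hφ, ← pow_mul, ← pow_mul]; congr 1; ring
  have e4 : ∀ x : F, x ^ (q ^ 4) = φ (φ (φ (φ x))) := fun x => by
    rw [← e3, hφ, ← pow_mul]; congr 1; ring
  have e5 : ∀ x : F, x ^ (q ^ 5) = φ (φ (φ (φ (φ x)))) := fun x => by
    rw [← e3, hφ, hφ, ← pow_mul, ← pow_mul]; congr 1; ring
  have e6 : ∀ x : F, φ (φ (φ (φ (φ (φ x))))) = x := fun x => by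
    rw [← e3, ← e3, ← pow_mul, ← pow_add]; exact hq6 x
  have h0 : h ≠ 0 := by
    rintro rfl
    rw [zero_pow (by omega)] at hh
    exact one_ne_zero (by linear_combination hh : (1 : F) = 0)
  have hqpos : 0 < q := hodd.pos
  have hφφ : φ (φ h) = h := by rw [← e2]; exact hq2
  have hφm : φ h * h = -1 := by
    rw [pow_succ, e3, hφφ] at hh; exact hh
  have hφh : φ h = -h⁻¹ := by
    field_simp; exact hφm
  have hφi : φ h⁻¹ = -h := by
    rw [map_inv₀, hφh]; field_simp
  have two : (2 : F) ≠ 0 := by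
    intro h2
    have hc2 : (Fintype.card F : F) = 0 := FiniteField.cast_card_eq_zero F
    have ho : Odd (Fintype.card F) := by rw [hF]; exact hodd.pow
    obtain ⟨m, hm⟩ := ho
    rw [hm] at hc2
    push_cast at hc2
    rw [h2] at hc2
    simp at hc2
  have hne1 : h - 1 ≠ 0 := by
    intro h1
    have : h = 1 := by linear_combination h1
    rw [this, map_one] at hφm
    exact two (by linear_combination hφm)
  have hne3 : 1 + h ^ 3 ≠ 0 := by
    intro h3
    have h3' : h ^ 3 = -1 := by linear_combination h3
    have hx : φ (h ^ 3) = -1 := by rw [h3', map_neg, map_one]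
    rw [map_pow] at hx
    have : (φ h * h) ^ 3 = 1 := by rw [mul_pow, hx, h3']; ring
    rw [hφm] at this
    exact two (by linear_combination -this)
  have hdet : a * d - b * c ≠ 0 := by
    have : a * d - b * c = 2 * h⁻¹ * (h - 1) * (1 + h ^ 3) := by
      rw [ha, hb, hc, hd]; field_simp; ring
    rw [this]
    exact mul_ne_zero (mul_ne_zero (mul_ne_zero two (inv_ne_zero h0)) hne1) hne3
  have hc1 : h ^ (q - 1) = -(h⁻¹) ^ 2 := by
    have : h ^ (q - 1) * h = φ h := by
      rw [← pow_succ, Nat.sub_add_cancel hqpos, hφ]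
    rw [hφh] at this
    field_simp at this ⊢
    linear_combination this
  have hc2 : h ^ (q ^ 2 - 1) = 1 := by
    have : h ^ (q ^ 2 - 1) * h = h := by
      rw [← pow_succ, Nat.sub_add_cancel (Nat.pos_of_ne_zero (by positivity)), hq2]
    exact mul_right_cancel₀ h0 (by rw [this, one_mul])
  have hf : ∀ x, fpol q h x
      = -(h⁻¹) ^ 2 * φ x - φ (φ x) + φ (φ (φ (φ x))) + φ (φ (φ (φ (φ x)))) := fun x => by
    rw [fpol, hc1, hc2, e2, e4, e5, hφ x, one_mul]
  have key : ∀ x, g (a * x + b * fpol q h x) = c * x + d * fpol q h x := fun x => by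
    have hi : h * h⁻¹ = 1 := mul_inv_cancel₀ h0
    rw [hg, ← hφ, e3, e5, hf, ha, hb, hc, hd]
    simp only [map_add, map_sub, map_mul, map_neg, map_pow, map_one, hφh, hφi, e6]
    generalize φ (φ (φ (φ (φ x)))) = x5
    generalize φ (φ (φ (φ x))) = x4
    generalize φ (φ (φ x)) = x3
    generalize φ (φ x) = x2
    generalize φ x = x1
    field_simp
    ring
  have inj2 : ∀ u v u' v' : F, a * u + b * v = a * u' + b * v' →
      c * u + d * v = c * u' + d * v' → u = u' ∧ v = v' := by
    intro u v u' v' h1 h2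
    constructor
    · exact mul_left_cancel₀ hdet (by linear_combination d * h1 - b * h2)
    · exact mul_left_cancel₀ hdet (by linear_combination a * h2 - c * h1)
  have inj : Function.Injective (fun x : F => a * x + b * fpol q h x) := by
    intro x y hxy
    have hxy' : a * x + b * fpol q h x = a * y + b * fpol q h y := hxy
    exact (inj2 _ _ _ _ hxy' (by rw [← key, ← key, hxy'])).1
  have surj := Finite.surjective_of_injective inj
  have f0 : fpol q h 0 = 0 := by rw [hf]; simp
  refine ⟨hdet, ?_, ?_⟩
  · ext p
    constructor
    · rintro ⟨_, ⟨x, rfl⟩, rfl⟩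
      exact ⟨a * x + b * fpol q h x, by rw [key]⟩
    · rintro ⟨y, rfl⟩
      obtain ⟨x, hx⟩ := surj y
      have hx' : a * x + b * fpol q h x = y := hx
      exact ⟨_, ⟨x, rfl⟩, by simp only [← key, hx']⟩
  · have injM : Function.Injective
        (fun p : F × F => (a * p.1 + b * p.2, c * p.1 + d * p.2)) := by
      rintro ⟨u, v⟩ ⟨u', v'⟩ hp
      have hp' := Prod.mk.inj hp
      have := inj2 _ _ _ _ hp'.1 hp'.2
      exact Prod.ext this.1 this.2
    refine ⟨RingEquiv.refl F,
      Equiv.ofBijective _ (Finite.injective_iff_bijective.1 injM), ?_, ?_, ?_⟩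
    · intro u v
      ext <;> simp <;> ring
    · intro r v
      ext <;> simp <;> ring
    · rintro ⟨u, v⟩ hv hgv
      simp only [linearSet, Set.mem_setOf_eq, Projectivization.mk_eq_mk_iff',
        Equiv.ofBijective_apply, Prod.smul_mk, smul_eq_mul, Prod.mk.injEq]
      constructor
      · rintro ⟨x, hx, r, h1, h2⟩
        refine ⟨a * x + b * fpol q h x, fun hy => hx (inj ?_), r, ?_, ?_⟩
        · simp only [hy, f0]; simp
        · rw [← h1, ← h2]; ring
        · rw [key, ← h1, ← h2]; ring
      · rintro ⟨y, hy, r, h1, h2⟩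
        obtain ⟨x, rfl⟩ := surj y
        simp only [key] at h1 h2 hy
        refine ⟨x, ?_, r, ?_⟩
        · rintro rfl
          apply hy; simp [f0]
        · exact inj2 _ _ _ _ (by linear_combination h1) (by linear_combination h2)
end
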